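/- For every α ∈ (0,1) there exists a constant K_α ∈ (0,∞) such that for every p ∈ [1,∞), every real normed space X, every n ∈ ℕ, and every function f : {-1,1}^n → X: ‖f − ∫_{{-1,1}^n} f dμ_α^n‖_{L_p(μ_α^n;X)} ≤ K_α·(log n + 1) · ( ∫_{{-1,1}^n} ‖Σ_{i=1}^n δ_i ∂_i^α f‖_{L_p(μ_α^n;X)}^p dσ_n(δ) )^{1/p}. -/

import Mathlib

open Finset

noncomputable section

/-- The real sign of a Boolean coordinate: `true ↦ 1`, `false ↦ -1`. -/
def sgn (b : Bool) : ℝ := if b then 1 else -1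

/-- Hamming distance on the discrete cube `{-1,1}^n ≃ Bool^n`. -/
def hamming {n : ℕ} (x y : Fin n → Bool) : ℕ :=
  (Finset.univ.filter fun i => x i ≠ y i).card

/-- Flip the `i`-th coordinate. -/
def flipc {ι : Type*} [DecidableEq ι] (x : ι → Bool) (i : ι) : ι → Bool :=
  Function.update x i (!(x i))

/-- Negate all coordinates (the antipodal map). -/
def negc {ι : Type*} (x : ι → Bool) : ι → Bool := fun i => !(x i)

/-- `X` has Rademacher type `p` with constant `T`. -/
def RademacherType (X : Type*) [NormedAddCommGroup X] [NormedSpace ℝ X] (p T : ℝ) : Prop :=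
  ∀ (m : ℕ) (v : Fin m → X),
    (2 ^ m : ℝ)⁻¹ * ∑ x : Fin m → Bool, ‖∑ i, sgn (x i) • v i‖ ^ p ≤
      T ^ p * ∑ i, ‖v i‖ ^ p

/-- `X` has cotype `q` with constant `Cq`. -/
def CotypeC (X : Type*) [NormedAddCommGroup X] [NormedSpace ℝ X] (q Cq : ℝ) : Prop :=
  ∀ (m : ℕ) (v : Fin m → X),
    (∑ i, ‖v i‖ ^ q) / Cq ^ q ≤
      (2 ^ m : ℝ)⁻¹ * ∑ x : Fin m → Bool, ‖∑ i, sgn (x i) • v i‖ ^ q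

open scoped Classical in
/-- The weak `ℓ_p` norm of a finite real vector. -/
def weakLp {ι : Type*} [Fintype ι] (p : ℝ) (w : ι → ℝ) : ℝ :=
  sSup {z | ∃ r : ℝ, 0 ≤ r ∧
    z = r * ((Finset.univ.filter fun i => r ≤ |w i|).card : ℝ) ^ (1 / p)}

/-- Metric stable type `p` with constant `S`. -/
def MetricStableType (M : Type*) [PseudoMetricSpace M] (p S : ℝ) : Prop :=
  ∀ (n : ℕ) (f : (Fin n → Bool) → M),
    (2 ^ n : ℝ)⁻¹ * ∑ x : Fin n → Bool, dist (f x) (f (negc x)) ^ p ≤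
      S ^ p * ((2 ^ n : ℝ)⁻¹ *
        ∑ x : Fin n → Bool, weakLp p (fun i => (1 / 2) * dist (f x) (f (flipc x i))) ^ p)

/-- The product biased measure weight of a point of the cube. -/
def biasedWeight {ι : Type*} [Fintype ι] (α : ι → ℝ) (x : ι → Bool) : ℝ :=
  ∏ i, if x i then α i else 1 - α i

/-- The biased discrete partial derivative `∂_i^α`. -/
def bder {ι : Type*} [DecidableEq ι] {X : Type*} [AddCommGroup X] [Module ℝ X]
    (α : ℝ) (i : ι) (f : (ι → Bool) → X) (x : ι → Bool) : X :=
  f x - (α • f (Function.update x i true) + (1 - α) • f (Function.update x i false))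

/-- The `L_p(μ; X)` norm with respect to the weight `μ` on the cube. -/
def lpNormW {ι : Type*} [Fintype ι] [DecidableEq ι] {X : Type*} [NormedAddCommGroup X]
    (μ : (ι → Bool) → ℝ) (p : ℝ) (g : (ι → Bool) → X) : ℝ :=
  (∑ x : ι → Bool, μ x * ‖g x‖ ^ p) ^ (1 / p)

/-- The Orlicz `L_p(log L)^{p/2}(μ; X)` norm with respect to the weight `μ` on the cube. -/
def orliczNormW {ι : Type*} [Fintype ι] [DecidableEq ι] {X : Type*} [NormedAddCommGroup X]
    (μ : (ι → Bool) → ℝ) (p : ℝ) (g : (ι → Bool) → X) : ℝ :=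
  sInf {γ : ℝ | 0 < γ ∧
    ∑ x : ι → Bool, (μ x * (‖g x‖ ^ p / γ ^ p)) *
      Real.log (Real.exp 1 + ‖g x‖ ^ p / γ ^ p) ^ (p / 2) ≤ 1}

/-- The one-dimensional transition kernel `p_t^α`. -/
def ptrans (t α : ℝ) : Bool → Bool → ℝ := fun a b =>
  match a, b with
  | true, true => 1 - (1 - Real.exp (-t)) * (1 - α)
  | true, false => (1 - Real.exp (-t)) * (1 - α)
  | false, true => (1 - Real.exp (-t)) * α
  | false, false => 1 - (1 - Real.exp (-t)) * α

/-- The matrix `η_t^α(·,·;θ)`. -/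
def eta (t α θ : ℝ) : Bool → Bool → ℝ := fun a b =>
  match a, b with
  | true, true => (Real.exp (-t) - θ) / ptrans t α true true
  | true, false => (-θ) / ptrans t α false true
  | false, true => (θ - Real.exp (-t)) / ptrans t α true false
  | false, false => θ / ptrans t α false false

/-- The product transition kernel `p_t^𝛂`. -/
def pprod {n : ℕ} (t : ℝ) (α : Fin n → ℝ) (x y : Fin n → Bool) : ℝ :=
  ∏ i, ptrans t (α i) (x i) (y i)

/-- Glue coordinates on `σ` (given by `x`) with coordinates off `σ` (given by `w`). -/
def glue {n : ℕ} (σ : Finset (Fin n)) (x : {i // i ∈ σ} → Bool) (w : Fin n → Bool) :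
    Fin n → Bool := fun j => if h : j ∈ σ then x ⟨j, h⟩ else w j

/-- The low-dimensional skeleton `𝒞_d^n` of the solid cube `[-1,1]^n`. -/
def cubeSkeleton (n d : ℕ) : Set (Fin n → ℝ) :=
  {x | (∀ i, |x i| ≤ 1) ∧ n - d ≤ {i | |x i| = 1}.ncard}

/-- The `ℓ_p^d` norm on `ℝ^d`. -/
def lpnorm (p : ℝ) {d : ℕ} (v : Fin d → ℝ) : ℝ := (∑ k, |v k| ^ p) ^ (1 / p)

/-- The weight of a single coordinate under the biased measure. -/
def coordWeight (α : ℝ) (b : Bool) : ℝ := if b then α else 1 - α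

/-- The one-coordinate noise kernel with correlation `ρ`. -/
def noiseKernel (α ρ : ℝ) (a b : Bool) : ℝ := ρ * (if a = b then 1 else 0) + (1 - ρ) * coordWeight α b

/-- The kernel of `I - E` in one coordinate, which is the `ρ`-derivative of `noiseKernel`. -/
def centeredKernel (α : ℝ) (a b : Bool) : ℝ := (if a = b then 1 else 0) - coordWeight α b

/-- Coupling of the noise kernel with a random sign whose conditional mean given the two endpoints
is proportional to `centeredKernel / noiseKernel`. -/
def signedKernel (α ρ s : ℝ) (a b d : Bool) : ℝ :=
  (noiseKernel α ρ a b + sgn d * (s * centeredKernel α a b)) / 2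

/-- The noise operator on the cube, with coordinate `i` replaced by the centered kernel. -/
def noiseDeriv {n : ℕ} {X : Type*} [AddCommGroup X] [Module ℝ X] (α : ℝ) (ρ : Fin n → ℝ)
    (i : Fin n) (f : (Fin n → Bool) → X) (x : Fin n → Bool) : X :=
  ∑ y : Fin n → Bool,
    (∏ j, if j = i then centeredKernel α (x j) (y j) else noiseKernel α (ρ j) (x j) (y j)) • f y

/-- The noise operator with correlation `ρ` on the biased cube. -/
def noiseOp {n : ℕ} {X : Type*} [AddCommGroup X] [Module ℝ X] (α ρ : ℝ)
    (f : (Fin n → Bool) → X) (x : Fin n → Bool) : X :=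
  ∑ y : Fin n → Bool, (∏ j, noiseKernel α ρ (x j) (y j)) • f y

theorem coordWeight_nonneg {α : ℝ} (h0 : 0 < α) (h1 : α < 1) (b : Bool) :
    0 ≤ coordWeight α b := by
  cases b <;> simp [coordWeight] <;> linarith

theorem biasedWeight_eq_prod {ι : Type*} [Fintype ι] (α : ℝ) (x : ι → Bool) :
    biasedWeight (fun _ : ι => α) x = ∏ i, coordWeight α (x i) := rfl

theorem biasedWeight_nonneg {ι : Type*} [Fintype ι] {α : ℝ} (h0 : 0 < α) (h1 : α < 1)
    (x : ι → Bool) : 0 ≤ biasedWeight (fun _ : ι => α) x := by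
  rw [biasedWeight_eq_prod]
  exact Finset.prod_nonneg fun i _ => coordWeight_nonneg h0 h1 _

/-- Summing a product kernel over the cube factors over coordinates. -/
theorem sum_cube_prod {n : ℕ} (g : Fin n → Bool → ℝ) :
    ∑ y : Fin n → Bool, ∏ j, g j (y j) = ∏ j, ∑ b, g j b := by
  rw [Finset.prod_univ_sum, Fintype.piFinset_univ]

theorem sum_signedKernel (α ρ s : ℝ) (a b : Bool) :
    ∑ d, signedKernel α ρ s a b d = noiseKernel α ρ a b := by
  simp [signedKernel, sgn]; ring

theorem sum_signedKernel_mul_sgn (α ρ s : ℝ) (a b : Bool) :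
    ∑ d, signedKernel α ρ s a b d * sgn d = s * centeredKernel α a b := by
  simp [signedKernel, sgn]; ring

theorem sum_noiseKernel (α ρ : ℝ) (a : Bool) : ∑ b, noiseKernel α ρ a b = 1 := by
  cases a <;> simp [noiseKernel, coordWeight] <;> ring

theorem sum_centeredKernel (α : ℝ) (a : Bool) : ∑ b, centeredKernel α a b = 0 := by
  cases a <;> simp [centeredKernel, coordWeight]

theorem sum_coordWeight_mul_signedKernel (α ρ s : ℝ) (b d : Bool) :
    ∑ a, coordWeight α a * signedKernel α ρ s a b d = coordWeight α b / 2 := by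
  cases b <;> cases d <;>
    simp [signedKernel, sgn, noiseKernel, centeredKernel, coordWeight] <;> ring

theorem signedKernel_half_nonneg {α : ℝ} (h0 : 0 < α) (h1 : α < 1) (a b d : Bool) :
    0 ≤ signedKernel α (1 / 2) (1 / 2) a b d := by
  cases a <;> cases b <;> cases d <;>
    simp [signedKernel, sgn, noiseKernel, centeredKernel, coordWeight] <;> nlinarith

theorem signedKernel_zero_nonneg {α ρ : ℝ} (h0 : 0 < α) (h1 : α < 1) (hρ0 : 0 ≤ ρ) (hρ1 : ρ ≤ 1)
    (a b d : Bool) : 0 ≤ signedKernel α ρ 0 a b d := by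
  have := mul_nonneg (sub_nonneg.2 hρ1) h0.le
  have := mul_nonneg (sub_nonneg.2 hρ1) (sub_nonneg.2 h1.le)
  cases a <;> cases b <;> cases d <;>
    simp [signedKernel, noiseKernel, coordWeight] <;> linarith

theorem signedKernel_nonneg {α ρ : ℝ} (h0 : 0 < α) (h1 : α < 1) (hρ0 : 0 ≤ ρ) (hρ1 : ρ ≤ 1)
    (a b d : Bool) : 0 ≤ signedKernel α ρ ((1 - ρ) * (α * (1 - α))) a b d := by
  have hα : 0 ≤ 1 - α := sub_nonneg.2 h1.le
  have hβ : α * (1 - α) ≤ 1 := by nlinarith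
  have hρ : 0 ≤ 1 - ρ := sub_nonneg.2 hρ1
  have e1 := mul_nonneg hρ h0.le
  have e2 := mul_nonneg hρ hα
  have e3 : 0 ≤ (1 - ρ) * α * (1 - α * (1 - α)) := mul_nonneg e1 (by linarith)
  have e4 : 0 ≤ (1 - ρ) * (1 - α) * (1 - α * (1 - α)) := mul_nonneg e2 (by linarith)
  have e5 : 0 ≤ (1 - ρ) * α * (α * (1 - α)) := by positivity
  have e6 : 0 ≤ (1 - ρ) * (1 - α) * (α * (1 - α)) := by positivity
  have e7 : 0 ≤ (1 - ρ) * α * (1 - (1 - α) * (1 - α)) := mul_nonneg e1 (by nlinarith)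
  have e8 : 0 ≤ (1 - ρ) * (1 - α) * (1 - α * α) := mul_nonneg e2 (by nlinarith)
  cases a <;> cases b <;> cases d <;>
    simp [signedKernel, sgn, noiseKernel, centeredKernel, coordWeight] <;> nlinarith

/-- Markov kernels contract `L_p` norms. -/
theorem sum_norm_kernel_rpow_le {ι κ X : Type*} [Fintype ι] [Fintype κ] [NormedAddCommGroup X]
    [NormedSpace ℝ X] {p : ℝ} (hp : 1 ≤ p) (μ : ι → ℝ) (ν : κ → ℝ) (Q : ι → κ → ℝ)
    (hμ : ∀ x, 0 ≤ μ x) (hQ : ∀ x z, 0 ≤ Q x z) (hQ1 : ∀ x, ∑ z, Q x z = 1)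
    (hQν : ∀ z, ∑ x, μ x * Q x z = ν z) (H : κ → X) :
    ∑ x, μ x * ‖∑ z, Q x z • H z‖ ^ p ≤ ∑ z, ν z * ‖H z‖ ^ p := by
  have key : ∀ x, ‖∑ z, Q x z • H z‖ ^ p ≤ ∑ z, Q x z * ‖H z‖ ^ p := fun x => by
    have h1 : ‖∑ z, Q x z • H z‖ ≤ ∑ z, Q x z * ‖H z‖ :=
      (norm_sum_le _ _).trans (Finset.sum_le_sum fun z _ => by
        rw [norm_smul, Real.norm_of_nonneg (hQ x z)])
    exact (Real.rpow_le_rpow (norm_nonneg _) h1 (by linarith)).trans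
      (Real.rpow_arith_mean_le_arith_mean_rpow _ _ _ (fun z _ => hQ x z) (hQ1 x)
        (fun z _ => norm_nonneg _) hp)
  calc ∑ x, μ x * ‖∑ z, Q x z • H z‖ ^ p
      ≤ ∑ x, μ x * ∑ z, Q x z * ‖H z‖ ^ p :=
        Finset.sum_le_sum fun x _ => mul_le_mul_of_nonneg_left (key x) (hμ x)
    _ = ∑ z, ν z * ‖H z‖ ^ p := by
        simp_rw [Finset.mul_sum]
        rw [Finset.sum_comm]
        refine Finset.sum_congr rfl fun z _ => ?_
        rw [← hQν z, Finset.sum_mul]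
        exact Finset.sum_congr rfl fun x _ => by ring

theorem flipc_flipc {ι : Type*} [DecidableEq ι] (x : ι → Bool) (i : ι) :
    flipc (flipc x i) i = x := by
  simp [flipc]

/-- A product kernel centered in coordinate `i` annihilates functions not depending on it. -/
theorem sum_centered_smul_eq_zero {n : ℕ} {X : Type*} [AddCommGroup X] [Module ℝ X]
    (i : Fin n) (W : Fin n → Bool → ℝ) (hW : ∑ b, W i b = 0) (g : (Fin n → Bool) → X)
    (hg : ∀ y, g (flipc y i) = g y) :
    ∑ y : Fin n → Bool, (∏ j, W j (y j)) • g y = 0 := by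
  refine Finset.sum_involution (fun y _ => flipc y i) ?_ ?_ (fun _ _ => Finset.mem_univ _)
    (fun y _ => flipc_flipc y i)
  · intro y _
    rw [hg, ← add_smul]
    convert zero_smul ℝ (g y)
    rw [← Finset.mul_prod_erase _ _ (Finset.mem_univ i),
      ← Finset.mul_prod_erase _ (fun j => W j (flipc y i j)) (Finset.mem_univ i)]
    have h : ∏ j ∈ univ.erase i, W j (flipc y i j) = ∏ j ∈ univ.erase i, W j (y j) :=
      Finset.prod_congr rfl fun j hj => by simp [flipc, Finset.ne_of_mem_erase hj]
    rw [h, ← add_mul]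
    convert zero_mul _
    have h0 : W i true + W i false = 0 := by simpa using hW
    cases hy : y i <;> simp [flipc, hy] <;> linarith
  · intro y _ _ h
    have := congrFun h i
    simp [flipc] at this

/-- The signed coupling turns Rademacher sums of biased derivatives into noise derivatives. -/
theorem sum_signedKernel_smul_bder {n : ℕ} {X : Type*} [AddCommGroup X] [Module ℝ X] (α : ℝ)
    (ρ s : Fin n → ℝ) (f : (Fin n → Bool) → X) (x : Fin n → Bool) :
    ∑ z : (Fin n → Bool) × (Fin n → Bool),
        (∏ j, signedKernel α (ρ j) (s j) (x j) (z.1 j) (z.2 j)) •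
          ∑ i, sgn (z.2 i) • bder α i f z.1 =
      ∑ i, s i • noiseDeriv α ρ i f x := by
  simp_rw [Finset.smul_sum]
  rw [Finset.sum_comm]
  refine Finset.sum_congr rfl fun i _ => ?_
  rw [Fintype.sum_prod_type, noiseDeriv, Finset.smul_sum]
  have h1 : ∀ y : Fin n → Bool,
      ∑ δ : Fin n → Bool, (∏ j, signedKernel α (ρ j) (s j) (x j) (y j) (δ j)) •
        sgn (δ i) • bder α i f y =
      s i • (∏ j, if j = i then centeredKernel α (x j) (y j)
        else noiseKernel α (ρ j) (x j) (y j)) • bder α i f y := fun y => by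
    simp_rw [smul_smul]
    rw [← Finset.sum_smul]
    congr 1
    have h2 : ∀ δ : Fin n → Bool,
        (∏ j, signedKernel α (ρ j) (s j) (x j) (y j) (δ j)) * sgn (δ i) =
        ∏ j, signedKernel α (ρ j) (s j) (x j) (y j) (δ j) *
          (if j = i then sgn (δ j) else 1) := fun δ => by
      rw [Finset.prod_mul_distrib, Finset.prod_ite_eq' _ _ fun j => sgn (δ j)]
      simp
    simp_rw [h2]
    rw [sum_cube_prod fun j d => signedKernel α (ρ j) (s j) (x j) (y j) d *
      (if j = i then sgn d else 1)]
    rw [← Finset.mul_prod_erase _ _ (Finset.mem_univ i),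
      ← Finset.mul_prod_erase _ _ (Finset.mem_univ i), ← mul_assoc]
    congr 1
    · simp only [if_true]
      exact sum_signedKernel_mul_sgn _ _ _ _ _
    · refine Finset.prod_congr rfl fun j hj => ?_
      simp only [Finset.ne_of_mem_erase hj, if_false, mul_one]
      exact sum_signedKernel _ _ _ _ _
  simp only [h1, ← Finset.smul_sum]
  congr 1
  simp only [bder, smul_sub (∏ _, _ : ℝ), Finset.sum_sub_distrib]
  rw [sub_eq_self]
  refine sum_centered_smul_eq_zero i (fun j b => if j = i then centeredKernel α (x j) b
    else noiseKernel α (ρ j) (x j) b) ?_ _ fun y => ?_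
  · simp only [if_true]
    exact sum_centeredKernel _ _
  · simp [flipc]

/-- The averaged `L_p` norm of Rademacher sums of the biased derivatives. -/
def rademacherGrad {n : ℕ} {X : Type*} [NormedAddCommGroup X] [NormedSpace ℝ X] (α p : ℝ)
    (f : (Fin n → Bool) → X) : ℝ :=
  ((2 ^ n : ℝ)⁻¹ * ∑ δ : Fin n → Bool,
    lpNormW (biasedWeight fun _ : Fin n => α) p
      (fun x => ∑ i, sgn (δ i) • bder α i f x) ^ p) ^ (1 / p)

theorem sum_mul_norm_rpow_nonneg {ι X : Type*} [Fintype ι] [NormedAddCommGroup X] {μ : ι → ℝ}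
    (hμ : ∀ x, 0 ≤ μ x) (p : ℝ) (g : ι → X) : 0 ≤ ∑ x, μ x * ‖g x‖ ^ p :=
  Finset.sum_nonneg fun x _ => mul_nonneg (hμ x) (by positivity)

theorem rademacherGrad_nonneg {n : ℕ} {X : Type*} [NormedAddCommGroup X] [NormedSpace ℝ X]
    {α : ℝ} (h0 : 0 < α) (h1 : α < 1) (p : ℝ) (f : (Fin n → Bool) → X) :
    0 ≤ rademacherGrad α p f := by
  have hw := biasedWeight_nonneg (ι := Fin n) h0 h1
  refine Real.rpow_nonneg (mul_nonneg (by positivity) (Finset.sum_nonneg fun δ _ => ?_)) _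
  exact Real.rpow_nonneg (Real.rpow_nonneg (sum_mul_norm_rpow_nonneg hw p _) _) _

theorem lpNormW_sum_noiseDeriv_le {n : ℕ} {X : Type*} [NormedAddCommGroup X] [NormedSpace ℝ X]
    {α p : ℝ} (h0 : 0 < α) (h1 : α < 1) (hp : 1 ≤ p) (ρ s : Fin n → ℝ)
    (hs : ∀ j a b d, 0 ≤ signedKernel α (ρ j) (s j) a b d) (f : (Fin n → Bool) → X) :
    lpNormW (biasedWeight fun _ : Fin n => α) p (fun x => ∑ i, s i • noiseDeriv α ρ i f x) ≤
      rademacherGrad α p f := by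
  have hw := biasedWeight_nonneg (ι := Fin n) h0 h1
  have hJ := sum_norm_kernel_rpow_le hp (biasedWeight fun _ : Fin n => α)
    (fun z : (Fin n → Bool) × (Fin n → Bool) =>
      (2 ^ n : ℝ)⁻¹ * biasedWeight (fun _ : Fin n => α) z.1)
    (fun x z => ∏ j, signedKernel α (ρ j) (s j) (x j) (z.1 j) (z.2 j)) hw
    (fun x z => Finset.prod_nonneg fun j _ => hs j _ _ _) ?_ ?_
    (fun z => ∑ i, sgn (z.2 i) • bder α i f z.1)
  · simp only [sum_signedKernel_smul_bder] at hJ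
    unfold rademacherGrad lpNormW
    refine Real.rpow_le_rpow (sum_mul_norm_rpow_nonneg hw p _) (hJ.trans_eq ?_) (by positivity)
    rw [Fintype.sum_prod_type, Finset.sum_comm, Finset.mul_sum]
    refine Finset.sum_congr rfl fun δ _ => ?_
    rw [← Real.rpow_mul (sum_mul_norm_rpow_nonneg hw p _), one_div_mul_cancel (by linarith), Real.rpow_one,
      Finset.mul_sum]
    exact Finset.sum_congr rfl fun x _ => by ring
  · intro x
    rw [Fintype.sum_prod_type]
    have h2 : ∀ y : Fin n → Bool,
        ∑ δ : Fin n → Bool, ∏ j, signedKernel α (ρ j) (s j) (x j) (y j) (δ j) =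
          ∏ j, noiseKernel α (ρ j) (x j) (y j) := fun y => by
      rw [sum_cube_prod fun j d => signedKernel α (ρ j) (s j) (x j) (y j) d]
      exact Finset.prod_congr rfl fun j _ => sum_signedKernel _ _ _ _ _
    simp only [h2]
    rw [sum_cube_prod fun j b => noiseKernel α (ρ j) (x j) b]
    exact Finset.prod_eq_one fun j _ => sum_noiseKernel _ _ _
  · intro z
    simp only [biasedWeight_eq_prod, ← Finset.prod_mul_distrib]
    rw [sum_cube_prod fun j a => coordWeight α a *
      signedKernel α (ρ j) (s j) a (z.1 j) (z.2 j)]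
    simp only [sum_coordWeight_mul_signedKernel, Finset.prod_div_distrib]
    simp [div_eq_inv_mul]

theorem hasDerivAt_noiseOp {n : ℕ} {X : Type*} [NormedAddCommGroup X] [NormedSpace ℝ X]
    (α : ℝ) (f : (Fin n → Bool) → X) (x : Fin n → Bool) (ρ : ℝ) :
    HasDerivAt (fun r => noiseOp α r f x) (∑ i, noiseDeriv α (fun _ => ρ) i f x) ρ := by
  have hk : ∀ a b, HasDerivAt (fun r => noiseKernel α r a b) (centeredKernel α a b) ρ :=
    fun a b => by
      unfold noiseKernel centeredKernel
      have := ((hasDerivAt_id ρ).mul_const (if a = b then (1 : ℝ) else 0)).add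
        (((hasDerivAt_id ρ).const_sub 1).mul_const (coordWeight α b))
      refine this.congr_deriv ?_
      ring
  unfold noiseOp noiseDeriv
  rw [Finset.sum_comm]
  refine HasDerivAt.fun_sum fun y _ => ?_
  rw [← Finset.sum_smul]
  refine HasDerivAt.smul_const ?_ _
  have := HasDerivAt.fun_finsetProd (u := univ) fun j _ => hk (x j) (y j)
  convert this using 1
  refine Finset.sum_congr rfl fun i _ => ?_
  rw [← Finset.mul_prod_erase _ _ (Finset.mem_univ i), smul_eq_mul, mul_comm]
  simp only [if_true]
  congr 1
  exact Finset.prod_congr rfl fun j hj => by simp [Finset.ne_of_mem_erase hj]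

theorem noiseOp_one {n : ℕ} {X : Type*} [AddCommGroup X] [Module ℝ X] (α : ℝ)
    (f : (Fin n → Bool) → X) (x : Fin n → Bool) : noiseOp α 1 f x = f x := by
  unfold noiseOp
  rw [Finset.sum_eq_single x]
  · simp [noiseKernel]
  · intro y _ hy
    obtain ⟨j, hj⟩ := Function.ne_iff.1 hy
    rw [Finset.prod_eq_zero (Finset.mem_univ j), zero_smul]
    simp [noiseKernel, Ne.symm hj]
  · simp

theorem noiseOp_zero {n : ℕ} {X : Type*} [AddCommGroup X] [Module ℝ X] (α : ℝ)
    (f : (Fin n → Bool) → X) (x : Fin n → Bool) :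
    noiseOp α 0 f x = ∑ y, biasedWeight (fun _ : Fin n => α) y • f y := by
  simp [noiseOp, noiseKernel, biasedWeight_eq_prod]

/-- The embedding of `L_p(μ; X)` into the unweighted `ℓ_p` space. -/
def weightedToLp {ι X : Type*} [NormedAddCommGroup X] [NormedSpace ℝ X] (μ : ι → ℝ) (p : ℝ)
    (g : ι → X) : PiLp (ENNReal.ofReal p) fun _ : ι => X :=
  WithLp.toLp _ fun x => μ x ^ (1 / p) • g x

theorem norm_weightedToLp {ι X : Type*} [Fintype ι] [DecidableEq ι] [NormedAddCommGroup X]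
    [NormedSpace ℝ X] {p : ℝ} (hp : 1 ≤ p) (μ : (ι → Bool) → ℝ) (hμ : ∀ x, 0 ≤ μ x)
    (g : (ι → Bool) → X) : ‖weightedToLp μ p g‖ = lpNormW μ p g := by
  have hp0 : 0 < p := by linarith
  have ht : (ENNReal.ofReal p).toReal = p := ENNReal.toReal_ofReal hp0.le
  rw [PiLp.norm_eq_sum (by rw [ht]; exact hp0), ht, lpNormW]
  congr 1
  refine Finset.sum_congr rfl fun x _ => ?_
  have h := Real.rpow_nonneg (hμ x) (1 / p)
  simp only [weightedToLp]
  rw [norm_smul, Real.norm_of_nonneg h, Real.mul_rpow h (norm_nonneg _),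
    ← Real.rpow_mul (hμ x), one_div_mul_cancel hp0.ne', Real.rpow_one]

theorem hasDerivAt_weightedToLp {ι X : Type*} [Fintype ι] [NormedAddCommGroup X]
    [NormedSpace ℝ X] {p : ℝ} [Fact (1 ≤ ENNReal.ofReal p)] (μ : ι → ℝ) (g : ℝ → ι → X)
    (g' : ι → X) (r : ℝ) (hg : ∀ x, HasDerivAt (fun r => g r x) (g' x) r) :
    HasDerivAt (fun r => weightedToLp μ p (g r)) (weightedToLp μ p g') r := by
  have h : HasDerivAt (fun r x => μ x ^ (1 / p) • g r x) (fun x => μ x ^ (1 / p) • g' x) r :=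
    hasDerivAt_pi.2 fun x => (hg x).const_smul _
  exact (PiLp.continuousLinearEquiv (ENNReal.ofReal p) ℝ
    fun _ : ι => X).symm.hasFDerivAt.comp_hasDerivAt r h

theorem weightedToLp_sub {ι X : Type*} [NormedAddCommGroup X] [NormedSpace ℝ X] (μ : ι → ℝ)
    (p : ℝ) (g h : ι → X) :
    weightedToLp μ p g - weightedToLp μ p h = weightedToLp μ p fun x => g x - h x := by
  ext x
  simp [weightedToLp, smul_sub]

theorem weightedToLp_sum {ι κ X : Type*} [NormedAddCommGroup X] [NormedSpace ℝ X] (μ : ι → ℝ)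
    (p : ℝ) (s : Finset κ) (g : κ → ι → X) :
    weightedToLp μ p (fun x => ∑ i ∈ s, g i x) = ∑ i ∈ s, weightedToLp μ p (g i) := by
  ext x
  simp [weightedToLp, Finset.smul_sum]

theorem weightedToLp_smul {ι X : Type*} [NormedAddCommGroup X] [NormedSpace ℝ X] (μ : ι → ℝ)
    (p c : ℝ) (g : ι → X) :
    weightedToLp μ p (fun x => c • g x) = c • weightedToLp μ p g := by
  ext x
  simp [weightedToLp, smul_comm c]

theorem norm_deriv_noiseOp_le_mul {n : ℕ} {X : Type*} [NormedAddCommGroup X] [NormedSpace ℝ X]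
    {α p ρ : ℝ} [Fact (1 ≤ ENNReal.ofReal p)] (h0 : 0 < α) (h1 : α < 1) (hp : 1 ≤ p)
    (hρ0 : 0 ≤ ρ) (hρ1 : ρ ≤ 1) (f : (Fin n → Bool) → X) :
    ‖weightedToLp (biasedWeight fun _ : Fin n => α) p
      (fun x => ∑ i, noiseDeriv α (fun _ => ρ) i f x)‖ ≤ 2 * n * rademacherGrad α p f := by
  have hw := biasedWeight_nonneg (ι := Fin n) h0 h1
  have key : ∀ i : Fin n, ‖weightedToLp (biasedWeight fun _ : Fin n => α) p
      (noiseDeriv α (fun _ => ρ) i f)‖ ≤ 2 * rademacherGrad α p f := fun i => by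
    have h := lpNormW_sum_noiseDeriv_le h0 h1 hp (fun j => if j = i then 1 / 2 else ρ)
      (fun j => if j = i then 1 / 2 else 0) (fun j a b d => by
        by_cases hj : j = i
        · simpa only [hj, if_true] using signedKernel_half_nonneg h0 h1 a b d
        · simpa only [hj, if_false] using signedKernel_zero_nonneg h0 h1 hρ0 hρ1 a b d) f
    have h2 : (fun x => ∑ k, (if k = i then (1 / 2 : ℝ) else 0) •
        noiseDeriv α (fun j => if j = i then 1 / 2 else ρ) k f x) =
        fun x => (1 / 2 : ℝ) • noiseDeriv α (fun _ => ρ) i f x := by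
      funext x
      rw [Finset.sum_eq_single i (fun k _ hk => by simp [hk]) (by simp), if_pos rfl]
      congr 1
      unfold noiseDeriv
      refine Finset.sum_congr rfl fun y _ => ?_
      congr 1
      refine Finset.prod_congr rfl fun j _ => ?_
      by_cases hj : j = i <;> simp [hj]
    rw [h2, ← norm_weightedToLp hp _ hw, weightedToLp_smul, norm_smul] at h
    norm_num at h
    linarith
  rw [weightedToLp_sum]
  refine (norm_sum_le _ _).trans ((Finset.sum_le_sum fun i _ => key i).trans_eq ?_)
  simp
  ring

theorem norm_deriv_noiseOp_le_div {n : ℕ} {X : Type*} [NormedAddCommGroup X] [NormedSpace ℝ X]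
    {α p ρ : ℝ} [Fact (1 ≤ ENNReal.ofReal p)] (h0 : 0 < α) (h1 : α < 1) (hp : 1 ≤ p)
    (hρ0 : 0 ≤ ρ) (hρ1 : ρ < 1) (f : (Fin n → Bool) → X) :
    ‖weightedToLp (biasedWeight fun _ : Fin n => α) p
      (fun x => ∑ i, noiseDeriv α (fun _ => ρ) i f x)‖ ≤
      (α * (1 - α))⁻¹ * rademacherGrad α p f * (1 - ρ)⁻¹ := by
  have hw := biasedWeight_nonneg (ι := Fin n) h0 h1
  have h := lpNormW_sum_noiseDeriv_le h0 h1 hp (fun _ => ρ)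
    (fun _ => (1 - ρ) * (α * (1 - α)))
    (fun j a b d => signedKernel_nonneg h0 h1 hρ0 hρ1.le a b d) f
  simp only [← Finset.smul_sum] at h
  have hα : 0 < 1 - α := sub_pos.2 h1
  have hρ : 0 < 1 - ρ := sub_pos.2 hρ1
  have hc : 0 < (1 - ρ) * (α * (1 - α)) := by positivity
  rw [← norm_weightedToLp hp _ hw, weightedToLp_smul, norm_smul, Real.norm_of_nonneg hc.le,
    mul_comm, ← le_div_iff₀ hc] at h
  refine h.trans_eq ?_
  field_simp

theorem norm_noiseOp_one_sub_zero_le {n : ℕ} (hn : 1 ≤ n) {X : Type*} [NormedAddCommGroup X]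
    [NormedSpace ℝ X] {α p : ℝ} [Fact (1 ≤ ENNReal.ofReal p)] (h0 : 0 < α) (h1 : α < 1)
    (hp : 1 ≤ p) (f : (Fin n → Bool) → X) :
    ‖weightedToLp (biasedWeight fun _ : Fin n => α) p (noiseOp α 1 f) -
      weightedToLp (biasedWeight fun _ : Fin n => α) p (noiseOp α 0 f)‖ ≤
      ((α * (1 - α))⁻¹ * Real.log n + 2) * rademacherGrad α p f := by
  set φ : ℝ → PiLp (ENNReal.ofReal p) fun _ : Fin n → Bool => X :=
    fun r => weightedToLp (biasedWeight fun _ : Fin n => α) p (noiseOp α r f)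
  set R := rademacherGrad α p f
  have hφ : ∀ r, HasDerivAt φ (weightedToLp (biasedWeight fun _ : Fin n => α) p
      (fun x => ∑ i, noiseDeriv α (fun _ => r) i f x)) r := fun r =>
    hasDerivAt_weightedToLp _ _ _ r fun x => hasDerivAt_noiseOp α f x r
  have hn0 : (0 : ℝ) < n := by exact_mod_cast hn
  have hn1 : (n : ℝ)⁻¹ ≤ 1 := inv_le_one_of_one_le₀ (by exact_mod_cast hn)
  have hni : 0 < (n : ℝ)⁻¹ := inv_pos.2 hn0
  have hA : ‖φ (1 - (n : ℝ)⁻¹) - φ 0‖ ≤ (α * (1 - α))⁻¹ * R * Real.log n := by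
    have hB : ∀ r ∈ Set.Ico (0 : ℝ) 1, HasDerivAt
        (fun r => (α * (1 - α))⁻¹ * R * -Real.log (1 - r))
        ((α * (1 - α))⁻¹ * R * (1 - r)⁻¹) r := fun r hr => by
      have := ((((hasDerivAt_id r).const_sub 1).log (sub_pos.2 hr.2).ne').neg).const_mul
        ((α * (1 - α))⁻¹ * R)
      refine this.congr_deriv ?_
      simp [neg_div]
    have hsub : ∀ r ∈ Set.Icc (0 : ℝ) (1 - (n : ℝ)⁻¹), r ∈ Set.Ico (0 : ℝ) 1 :=
      fun r hr => ⟨hr.1, by linarith [hr.2]⟩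
    have := image_norm_le_of_norm_deriv_right_le_deriv_boundary'
      (f := fun r => φ r - φ 0) (a := 0) (b := 1 - (n : ℝ)⁻¹)
      (fun r _ => ((hφ r).sub_const (φ 0)).continuousAt.continuousWithinAt)
      (fun r _ => ((hφ r).sub_const (φ 0)).hasDerivWithinAt)
      (B := fun r => (α * (1 - α))⁻¹ * R * -Real.log (1 - r)) (by simp)
      (fun r hr => (hB r (hsub r hr)).continuousAt.continuousWithinAt)
      (fun r hr => (hB r (hsub r (Set.Ico_subset_Icc_self hr))).hasDerivWithinAt)
      (fun r hr => norm_deriv_noiseOp_le_div h0 h1 hp hr.1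
        (hsub r (Set.Ico_subset_Icc_self hr)).2 f)
      (x := 1 - (n : ℝ)⁻¹) ⟨by linarith, le_rfl⟩
    simpa [Real.log_inv] using this
  have hC : ‖φ 1 - φ (1 - (n : ℝ)⁻¹)‖ ≤ 2 * n * R * (1 - (1 - (n : ℝ)⁻¹)) :=
    norm_image_sub_le_of_norm_deriv_le_segment' (fun r _ => (hφ r).hasDerivWithinAt)
      (fun r hr => norm_deriv_noiseOp_le_mul h0 h1 hp (by linarith [hr.1]) hr.2.le f)
      1 ⟨by linarith, le_rfl⟩
  have hC' : 2 * n * R * (1 - (1 - (n : ℝ)⁻¹)) = 2 * R := by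
    field_simp
    ring
  calc ‖φ 1 - φ 0‖ = ‖(φ 1 - φ (1 - (n : ℝ)⁻¹)) + (φ (1 - (n : ℝ)⁻¹) - φ 0)‖ := by
        rw [sub_add_sub_cancel]
    _ ≤ _ := (norm_add_le _ _).trans (by linarith)

/-- The biased Pisier inequality with a `log n` factor: the constant
`K_α` depends only on `α` (uniformly in `p ∈ [1,∞)`). -/
theorem stmt12 (α : ℝ) (hα0 : 0 < α) (hα1 : α < 1) :
    ∃ K : ℝ, 0 < K ∧
      ∀ (p : ℝ), 1 ≤ p →
      ∀ (X : Type) [NormedAddCommGroup X] [NormedSpace ℝ X],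
      ∀ (n : ℕ) (f : (Fin n → Bool) → X),
      lpNormW (biasedWeight fun _ : Fin n => α) p
          (fun x => f x - ∑ y : Fin n → Bool, biasedWeight (fun _ : Fin n => α) y • f y) ≤
        K * (Real.log n + 1) * ((2 ^ n : ℝ)⁻¹ * ∑ δ : Fin n → Bool,
            lpNormW (biasedWeight fun _ : Fin n => α) p
              (fun x => ∑ i, sgn (δ i) • bder α i f x) ^ p) ^ (1 / p) := by
  have hα : 0 < 1 - α := sub_pos.2 hα1
  have hK : 2 ≤ (α * (1 - α))⁻¹ := by
    rw [le_inv_comm₀ (by norm_num) (by positivity)]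
    nlinarith [sq_nonneg (α - 1 / 2)]
  refine ⟨(α * (1 - α))⁻¹, by positivity, fun p hp X _ _ n f => ?_⟩
  have hw := biasedWeight_nonneg (ι := Fin n) hα0 hα1
  have : Fact (1 ≤ ENNReal.ofReal p) := ⟨ENNReal.one_le_ofReal.2 hp⟩
  have hR := rademacherGrad_nonneg hα0 hα1 p f
  change _ ≤ _ * _ * rademacherGrad α p f
  rw [← norm_weightedToLp hp _ hw, ← weightedToLp_sub]
  rcases Nat.eq_zero_or_pos n with rfl | hn
  · have h : f = fun _ => ∑ y, biasedWeight (fun _ : Fin 0 => α) y • f y := by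
      funext x
      simp only [biasedWeight, Finset.univ_eq_empty, Finset.prod_empty, one_smul,
        Fintype.sum_unique]
      exact congrArg f (Subsingleton.elim _ _)
    rw [← h, sub_self, norm_zero]
    simp only [Nat.cast_zero, Real.log_zero]
    positivity
  · have h := norm_noiseOp_one_sub_zero_le hn hα0 hα1 hp f
    rw [funext (noiseOp_one α f), funext (noiseOp_zero α f)] at h
    exact h.trans (mul_le_mul_of_nonneg_right (by linarith) hR)
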